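/- arXiv:1810.04116 — 8 statements merged into one kernel-verified Lean document; each statement's English description precedes it below -/
import Mathlib

section
/- (SSO lower bound) Let V₁, …, V_N be closed subspaces of V with V = V₁ + ⋯ + V_N. Let v₀ ∈ V and, for i = 1, …, N, let e_i ∈ V_i be the minimizer over V_i of w ↦ E(v_{i−1} + w), and set v_i := v_{i−1} + e_i. If E satisfies assumption (E1), then E(v₀) − E(v_N) ≥ (μ/2) Σ_{i=1}^N ‖e_i‖². -/
/-- SSO lower bound: one iteration of the successive subspace optimization
method decreases the energy by at least (μ/2) Σ ‖e_i‖². -/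
theorem stmt_7
    {V : Type*} [NormedAddCommGroup V] [InnerProductSpace ℝ V] [CompleteSpace V]
    (E : V → ℝ) (E' : V → V →L[ℝ] ℝ)
    (hdiff : ∀ v : V, HasFDerivAt E (E' v) v)
    (μ : ℝ) (hμ : 0 < μ)
    (hE1 : ∀ v w : V, μ * ‖w - v‖ ^ 2 ≤ E' w (w - v) - E' v (w - v))
    (N : ℕ) (Vsub : Fin N → Submodule ℝ V)
    (hclosed : ∀ i, IsClosed ((Vsub i : Set V)))
    (hspan : ∀ x : V, ∃ c : Fin N → V, (∀ i, c i ∈ Vsub i) ∧ x = ∑ i, c i)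
    (v : Fin (N + 1) → V) (e : Fin N → V)
    (he : ∀ i, e i ∈ Vsub i)
    (hmin : ∀ i, ∀ w ∈ Vsub i, E (v i.castSucc + e i) ≤ E (v i.castSucc + w))
    (hstep : ∀ i, v i.succ = v i.castSucc + e i) :
    μ / 2 * ∑ i, ‖e i‖ ^ 2 ≤ E (v 0) - E (v (Fin.last N)) := by
  have key : ∀ i, μ / 2 * ‖e i‖ ^ 2 ≤ E (v i.castSucc) - E (v i.succ) := by
    intro i
    have hd : ∀ t : ℝ, HasDerivAt (fun t : ℝ => E (v i.succ - t • e i))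
        (E' (v i.succ - t • e i) (-(e i))) t := by
      intro t
      have h1 : HasDerivAt (fun t : ℝ => v i.succ - t • e i) (-(e i)) t := by
        simpa using ((hasDerivAt_id t).smul_const (e i)).const_sub (v i.succ)
      exact (hdiff _).comp_hasDerivAt t h1
    have h0 : E' (v i.succ) (e i) = 0 := by
      have hm : IsLocalMin (fun t : ℝ => E (v i.succ - t • e i)) 0 := by
        refine Filter.Eventually.of_forall fun t => ?_
        have := hmin i ((1 - t) • e i) ((Vsub i).smul_mem _ (he i))
        have h2 : v i.succ - t • e i = v i.castSucc + (1 - t) • e i := by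
          rw [hstep, sub_smul, one_smul]; abel
        simp only [h2, zero_smul, sub_zero]
        rw [hstep]
        simpa using this
      have := hm.hasDerivAt_eq_zero (hd 0)
      simpa using this
    have hd2 : ∀ t : ℝ, HasDerivAt
        (fun t : ℝ => E (v i.succ - t • e i) - μ / 2 * ‖e i‖ ^ 2 * t ^ 2)
        (E' (v i.succ - t • e i) (-(e i)) - μ / 2 * ‖e i‖ ^ 2 * (2 * t)) t := by
      intro t
      have hp : HasDerivAt (fun t : ℝ => μ / 2 * ‖e i‖ ^ 2 * t ^ 2)
          (μ / 2 * ‖e i‖ ^ 2 * (2 * t)) t := by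
        simpa using (hasDerivAt_pow 2 t).const_mul (μ / 2 * ‖e i‖ ^ 2)
      exact (hd t).sub hp
    have hmono : MonotoneOn
        (fun t : ℝ => E (v i.succ - t • e i) - μ / 2 * ‖e i‖ ^ 2 * t ^ 2) (Set.Icc 0 1) := by
      refine monotoneOn_of_deriv_nonneg (convex_Icc 0 1)
        (fun t _ => (hd2 t).continuousAt.continuousWithinAt)
        (fun t _ => (hd2 t).differentiableAt.differentiableWithinAt) ?_
      intro t ht
      rw [interior_Icc] at ht
      rw [(hd2 t).deriv]
      have h := hE1 (v i.succ - t • e i) (v i.succ)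
      rw [sub_sub_cancel, map_smul, map_smul, h0, norm_smul, mul_pow, Real.norm_eq_abs,
        sq_abs] at h
      simp only [smul_eq_mul, mul_zero, zero_sub] at h
      rw [map_neg]
      have h3 : t * (μ * ‖e i‖ ^ 2 * t) ≤ t * (-(E' (v i.succ - t • e i) (e i))) := by
        linarith
      have := le_of_mul_le_mul_left h3 ht.1
      linarith
    have := hmono (Set.left_mem_Icc.2 zero_le_one) (Set.right_mem_Icc.2 zero_le_one) zero_le_one
    have h4 : v i.succ - e i = v i.castSucc := by rw [hstep]; abel
    simp only [zero_smul, sub_zero, one_smul, h4] at this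
    linarith
  have h1 := Fin.sum_univ_castSucc (fun j => E (v j))
  have h2 := Fin.sum_univ_succ (fun j => E (v j))
  have h3 := Finset.sum_le_sum (fun i (_ : i ∈ Finset.univ) => key i)
  rw [Finset.sum_sub_distrib, ← Finset.mul_sum] at h3
  linarith
end

section
/- (SSO upper bound) Let V₁, …, V_N be closed subspaces of V with V = V₁ + ⋯ + V_N satisfying (SS1) with constant C_A and (SS2) with constant C_S, and suppose E satisfies (E1). Let u₀ = v₀ ∈ V with v₀ ∈ B, and for i = 1, …, N let e_i ∈ V_i minimize w ↦ E(v_{i−1} + w) over V_i, v_i := v_{i−1} + e_i. Let u be the global minimizer of E. Then E(v_N) − E(u) ≤ (C_S² C_A²/(2μ)) Σ_{i=1}^N ‖e_i‖². -/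
theorem aux_strong {V : Type*} [NormedAddCommGroup V] [InnerProductSpace ℝ V]
    (E : V → ℝ) (E' : V → V →L[ℝ] ℝ)
    (hdiff : ∀ v : V, HasFDerivAt E (E' v) v)
    (μ : ℝ)
    (hE1 : ∀ v w : V, μ * ‖w - v‖ ^ 2 ≤ E' w (w - v) - E' v (w - v)) (a d : V) :
    E a + E' a d + μ / 2 * ‖d‖ ^ 2 ≤ E (a + d) := by
  have hd : ∀ t : ℝ, HasDerivAt (fun t : ℝ => E (a + t • d) - t * E' a d - μ / 2 * ‖d‖ ^ 2 * t ^ 2)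
      (E' (a + t • d) d - E' a d - μ * ‖d‖ ^ 2 * t) t := by
    intro t
    have h1 : HasDerivAt (fun t : ℝ => a + t • d) d t := by
      simpa using ((hasDerivAt_id t).smul_const d).const_add a
    have h2 := (hdiff (a + t • d)).comp_hasDerivAt t h1
    have h3 := ((hasDerivAt_id t).mul_const (E' a d))
    have h4 := ((hasDerivAt_pow 2 t).const_mul (μ / 2 * ‖d‖ ^ 2))
    refine ((h2.sub h3).sub h4).congr_deriv ?_
    simp; ring
  have hm : MonotoneOn (fun t : ℝ => E (a + t • d) - t * E' a d - μ / 2 * ‖d‖ ^ 2 * t ^ 2)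
      (Set.Icc 0 1) := by
    apply monotoneOn_of_deriv_nonneg (convex_Icc 0 1)
    · exact fun t _ => (hd t).continuousAt.continuousWithinAt
    · exact fun t _ => (hd t).differentiableAt.differentiableWithinAt
    · intro t ht
      rw [interior_Icc] at ht
      rw [(hd t).deriv]
      have h := hE1 a (a + t • d)
      simp only [add_sub_cancel_left, norm_smul, map_smul, smul_eq_mul, mul_pow,
        Real.norm_eq_abs, sq_abs] at h
      have ht0 := ht.1
      by_contra hc
      push Not at hc
      nlinarith [mul_neg_of_pos_of_neg ht0 hc]
  have := hm (Set.left_mem_Icc.2 zero_le_one) (Set.right_mem_Icc.2 zero_le_one) zero_le_one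
  simp at this
  linarith

theorem aux_tele {N : ℕ} (G : Fin (N + 1) → ℝ) (i : Fin N) :
    ∑ j ∈ Finset.univ.filter (fun j => i < j), (G j.succ - G j.castSucc)
      = G (Fin.last N) - G i.succ := by
  have key : ∀ H : Fin (N + 1) → ℝ, ∑ j : Fin N, (H j.succ - H j.castSucc)
      = H (Fin.last N) - H 0 := by
    intro H
    have h1 := Fin.sum_univ_castSucc H
    have h2 := Fin.sum_univ_succ H
    rw [Finset.sum_sub_distrib]; linarith
  have := key (fun j => if i.succ ≤ j then G j else G i.succ)
  rw [if_pos (Fin.le_last _), if_neg (by simp [Fin.le_def])] at this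
  rw [← this, Finset.sum_filter]
  apply Finset.sum_congr rfl
  intro j _
  have q1 : i.succ ≤ j.succ ↔ i ≤ j := Fin.succ_le_succ_iff
  have q2 : i.succ ≤ j.castSucc ↔ i < j := Fin.succ_le_castSucc_iff
  simp only [q1, q2]
  rcases lt_trichotomy i j with h | h | h
  · rw [if_pos h, if_pos h.le, if_pos h]
  · subst h
    simp
  · rw [if_neg h.le.not_gt, if_neg h.not_ge, if_neg h.le.not_gt]
    simp

theorem aux_ev {V : Type*} [NormedAddCommGroup V] [InnerProductSpace ℝ V]
    (E : V → ℝ) (hE : Continuous E) (c : ℝ) (a d f : V)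
    (h : ∀ t ∈ Set.Icc (0:ℝ) 1, E (a + t • d) < c) :
    ∀ᶠ n : ℕ in Filter.atTop, ∀ t ∈ Set.Icc (0:ℝ) 1,
      E (a + t • d + (1 / ((n:ℝ) + 1)) • f) ≤ c := by
  have h0 : ∀ᶠ s : ℝ in nhds 0, ∀ t ∈ Set.Icc (0:ℝ) 1, E (a + t • d + s • f) < c := by
    apply isCompact_Icc.eventually_forall_of_forall_eventually
    intro t ht
    have hc : Continuous (fun z : ℝ × ℝ => E (a + z.2 • d + z.1 • f)) := by fun_prop
    have := hc.continuousAt (x := ((0:ℝ), t))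
    have h2 : E (a + ((0:ℝ), t).2 • d + ((0:ℝ), t).1 • f) < c := by simpa using h t ht
    exact this.eventually_lt_const h2
  filter_upwards [tendsto_one_div_add_atTop_nhds_zero_nat.eventually h0] with n hn t ht
  exact (hn t ht).le


/-- SSO upper bound: under (E1), (SS1) and (SS2), the optimality gap after one
SSO iteration is bounded by (C_S² C_A² / (2μ)) Σ ‖e_i‖². -/
theorem stmt_8
    {V : Type*} [NormedAddCommGroup V] [InnerProductSpace ℝ V] [CompleteSpace V]
    (E : V → ℝ) (E' : V → V →L[ℝ] ℝ)
    (hdiff : ∀ v : V, HasFDerivAt E (E' v) v)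
    (μ : ℝ) (hμ : 0 < μ)
    (hE1 : ∀ v w : V, μ * ‖w - v‖ ^ 2 ≤ E' w (w - v) - E' v (w - v))
    (u₀ : V)
    (N : ℕ) (Vsub : Fin N → Submodule ℝ V)
    (hclosed : ∀ i, IsClosed ((Vsub i : Set V)))
    (CA CS : ℝ) (hCA : 0 < CA) (hCS : 0 < CS)
    (hSS1 : ∀ x : V, ∃ c : Fin N → V, (∀ i, c i ∈ Vsub i) ∧ x = ∑ i, c i ∧
      ∑ i, ‖c i‖ ^ 2 ≤ CA ^ 2 * ‖x‖ ^ 2)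
    (hSS2 : ∀ (w : Fin N → Fin N → V) (uu vv : Fin N → V),
      (∀ i j, E (w i j) ≤ E u₀) → (∀ i, uu i ∈ Vsub i) → (∀ i, vv i ∈ Vsub i) →
      (∀ i j, E (w i j + uu i) ≤ E u₀) →
      ∑ i, ∑ j ∈ Finset.univ.filter (fun j => i < j),
          (E' (w i j + uu j) (vv i) - E' (w i j) (vv i)) ≤
        CS * Real.sqrt (∑ i, ‖uu i‖ ^ 2) * Real.sqrt (∑ i, ‖vv i‖ ^ 2))
    (u : V) (hu : ∀ x : V, E u ≤ E x)
    (v : Fin (N + 1) → V) (hv0 : E (v 0) ≤ E u₀)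
    (e : Fin N → V)
    (he : ∀ i, e i ∈ Vsub i)
    (hmin : ∀ i, ∀ w ∈ Vsub i, E (v i.castSucc + e i) ≤ E (v i.castSucc + w))
    (hstep : ∀ i, v i.succ = v i.castSucc + e i) :
    E (v (Fin.last N)) - E u ≤ CS ^ 2 * CA ^ 2 / (2 * μ) * ∑ i, ‖e i‖ ^ 2 := by
  have hsc := aux_strong E E' hdiff μ hE1
  have hcont : Continuous E := continuous_iff_continuousAt.2 fun x => (hdiff x).continuousAt
  -- first-order optimality
  have hopt : ∀ i, ∀ y ∈ Vsub i, E' (v i.succ) y = 0 := by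
    intro i y hy
    have h1 : HasDerivAt (fun t : ℝ => v i.succ + t • y) y 0 := by
      simpa using ((hasDerivAt_id (0:ℝ)).smul_const y).const_add (v i.succ)
    have h2 : HasFDerivAt E (E' (v i.succ)) (v i.succ + (0:ℝ) • y) := by
      simpa using hdiff (v i.succ)
    have h3 := h2.comp_hasDerivAt (0:ℝ) h1
    refine IsLocalMin.hasDerivAt_eq_zero (Filter.Eventually.of_forall fun t => ?_) h3
    simp only [Function.comp, zero_smul, add_zero]
    rw [hstep, add_assoc]
    exact hmin i _ ((Vsub i).add_mem (he i) ((Vsub i).smul_mem t hy))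
  have hdec : ∀ i : Fin N, E (v i.succ) + μ / 2 * ‖e i‖ ^ 2 ≤ E (v i.castSucc) := by
    intro i
    have := hsc (v i.succ) (-e i)
    rw [map_neg, hopt i _ (he i), norm_neg] at this
    have h2 : v i.succ + -e i = v i.castSucc := by rw [hstep]; abel
    rw [h2] at this
    linarith
  have hanti : Antitone (fun i => E (v i)) := by
    rw [Fin.antitone_iff_succ_le]
    intro i
    have := hdec i
    have h2 : 0 ≤ μ / 2 * ‖e i‖ ^ 2 := by positivity
    show E (v i.succ) ≤ E (v i.castSucc)
    linarith
  have hseg : ∀ j : Fin N, ∀ t ∈ Set.Icc (0:ℝ) 1,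
      E (v j.castSucc + t • e j) ≤ E (v j.castSucc) := by
    intro j t ht
    have h1 := hsc (v j.castSucc + t • e j) (-(t • e j))
    have h2 := hsc (v j.castSucc + t • e j) ((1 - t) • e j)
    have e1 : v j.castSucc + t • e j + -(t • e j) = v j.castSucc := by abel
    have e2 : v j.castSucc + t • e j + (1 - t) • e j = v j.succ := by
      rw [hstep]; module
    rw [e1, map_neg, map_smul, smul_eq_mul] at h1
    rw [e2, map_smul, smul_eq_mul] at h2
    have h3 : E (v j.succ) ≤ E (v j.castSucc) :=
      hanti (Fin.castSucc_lt_succ).le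
    have p1 : 0 ≤ μ / 2 * ‖-(t • e j)‖ ^ 2 := by positivity
    have p2 : 0 ≤ μ / 2 * ‖(1 - t) • e j‖ ^ 2 := by positivity
    have ht0 := ht.1
    have ht1 := ht.2
    set D := E' (v j.castSucc + t • e j) (e j)
    rcases le_total D 0 with hD | hD
    · nlinarith [mul_nonneg ht0 (neg_nonneg.2 hD)]
    · nlinarith [mul_nonneg (sub_nonneg.2 ht1) hD]
  have hB : ∀ i, E (v i) ≤ E u₀ := fun i => (hanti (Fin.zero_le i)).trans hv0
  have hstrict : ∀ i : Fin N, e i ≠ 0 → E (v i.succ) < E u₀ := by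
    intro i hi
    have := hdec i
    have h2 : 0 < μ / 2 * ‖e i‖ ^ 2 := by
      have := norm_pos_iff.2 hi
      positivity
    linarith [hB i.castSucc]
  let a : Fin N → Fin N → V := fun i j => if i < j then v j.castSucc else u
  let d : Fin N → Fin N → V := fun i j => if i < j then e j else 0
  have hadB : ∀ i j, ∀ t ∈ Set.Icc (0:ℝ) 1, E (a i j + t • d i j) ≤ E u₀ := by
    intro i j t ht
    by_cases hij : i < j
    · simp only [a, d, if_pos hij]
      exact (hseg j t ht).trans (hB _)
    · simp only [a, d, if_neg hij, smul_zero, add_zero]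
      exact hu _
  have hev : ∀ᶠ n : ℕ in Filter.atTop, ∀ i j : Fin N, ∀ t ∈ Set.Icc (0:ℝ) 1,
      E (a i j + t • d i j + (1 / ((n:ℝ) + 1)) • e i) ≤ E u₀ := by
    rw [Filter.eventually_all]
    intro i
    rw [Filter.eventually_all]
    intro j
    by_cases hi : e i = 0
    · refine Filter.Eventually.of_forall fun n t ht => ?_
      rw [hi, smul_zero, add_zero]
      exact hadB i j t ht
    · apply aux_ev E hcont
      intro t ht
      refine lt_of_le_of_lt ?_ (hstrict i hi)
      by_cases hij : i < j
      · simp only [a, d, if_pos hij]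
        refine (hseg j t ht).trans (hanti ?_)
        simp only [Fin.le_def, Fin.lt_def, Fin.val_succ, Fin.val_castSucc] at *
        omega
      · simp only [a, d, if_neg hij, smul_zero, add_zero]
        exact hu _
  obtain ⟨n, hn⟩ := hev.exists
  obtain ⟨c, hc, hx, hcle⟩ := hSS1 (v (Fin.last N) - u)
  have hm : (0:ℝ) < (n:ℝ) + 1 := by positivity
  set S := Real.sqrt (∑ i, ‖e i‖ ^ 2) with hS
  set T := Real.sqrt (∑ i, ‖c i‖ ^ 2) with hT
  have hk : ∀ k ∈ Finset.range (n + 1),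
      ∑ i, ∑ j ∈ Finset.univ.filter (fun j => i < j),
        (E' (v j.castSucc + (((k + 1 : ℕ) : ℝ) / ((n:ℝ) + 1)) • e j) (c i)
          - E' (v j.castSucc + ((k : ℝ) / ((n:ℝ) + 1)) • e j) (c i))
        ≤ CS * (1 / ((n:ℝ) + 1) * S) * T := by
    intro k hk
    have hkn : (k:ℝ) ≤ n := by
      have := Finset.mem_range.1 hk
      exact_mod_cast Nat.lt_succ_iff.1 this
    have ht : (k : ℝ) / ((n:ℝ) + 1) ∈ Set.Icc (0:ℝ) 1 :=
      ⟨by positivity, by rw [div_le_one hm]; linarith⟩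
    have := hSS2 (fun i j => a i j + ((k : ℝ) / ((n:ℝ) + 1)) • d i j)
      (fun i => (1 / ((n:ℝ) + 1)) • e i) c (fun i j => hadB i j _ ht)
      (fun i => (Vsub i).smul_mem _ (he i)) hc (fun i j => hn i j _ ht)
    have hsq : Real.sqrt (∑ i, ‖(1 / ((n:ℝ) + 1)) • e i‖ ^ 2) = 1 / ((n:ℝ) + 1) * S := by
      simp only [norm_smul, mul_pow, ← Finset.mul_sum]
      rw [Real.sqrt_mul (by positivity), Real.sqrt_sq (norm_nonneg _), Real.norm_of_nonneg (by positivity)]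
    rw [hsq] at this
    refine le_of_eq_of_le ?_ this
    refine Finset.sum_congr rfl fun i _ => Finset.sum_congr rfl fun j hj => ?_
    have hij : i < j := (Finset.mem_filter.1 hj).2
    simp only [a, d, if_pos hij]
    rw [add_assoc, ← add_smul]
    congr 5
    push_cast
    ring
  have hsum := Finset.sum_le_sum hk
  rw [Finset.sum_const, Finset.card_range, nsmul_eq_mul] at hsum
  have hR : ((n + 1 : ℕ) : ℝ) * (CS * (1 / ((n:ℝ) + 1) * S) * T) = CS * S * T := by
    push_cast; field_simp
  rw [hR, Finset.sum_comm] at hsum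
  have hL : E' (v (Fin.last N)) (v (Fin.last N) - u) ≤ CS * S * T := by
    refine le_of_eq_of_le ?_ hsum
    conv_lhs => rw [hx, map_sum]
    refine Finset.sum_congr rfl fun i _ => ?_
    rw [Finset.sum_comm]
    have := aux_tele (fun j => E' (v j) (c i)) i
    rw [hopt i _ (hc i), sub_zero] at this
    rw [← this]
    refine Finset.sum_congr rfl fun j _ => ?_
    rw [Finset.sum_range_sub (fun k : ℕ => E' (v j.castSucc + ((k : ℝ) / ((n:ℝ) + 1)) • e j) (c i))]
    have h1 : (((n + 1 : ℕ) : ℝ) / ((n:ℝ) + 1)) = 1 := by push_cast; exact div_self hm.ne'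
    rw [h1]
    simp [hstep]
  have hTle : T ≤ CA * ‖v (Fin.last N) - u‖ := by
    rw [hT]
    apply Real.sqrt_le_iff.2 ⟨by positivity, ?_⟩
    rw [mul_pow]; exact hcle
  have hfin := hsc (v (Fin.last N)) (u - v (Fin.last N))
  rw [add_sub_cancel, ← neg_sub (v (Fin.last N)) u, map_neg, norm_neg] at hfin
  have hSS : S ^ 2 = ∑ i, ‖e i‖ ^ 2 := Real.sq_sqrt (by positivity)
  rw [← hSS]
  set X := ‖v (Fin.last N) - u‖
  have hS0 : 0 ≤ S := Real.sqrt_nonneg _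
  have h5 : CS * S * T ≤ CS * S * (CA * X) := by gcongr
  have h6 : CS * S * (CA * X) - μ / 2 * X ^ 2 ≤ CS ^ 2 * CA ^ 2 / (2 * μ) * S ^ 2 := by
    have h7 : CS ^ 2 * CA ^ 2 / (2 * μ) * S ^ 2 - (CS * S * (CA * X) - μ / 2 * X ^ 2)
        = (CS * S * CA - μ * X) ^ 2 / (2 * μ) := by
      field_simp
      ring
    have h8 : 0 ≤ (CS * S * CA - μ * X) ^ 2 / (2 * μ) := by positivity
    linarith
  linarith
end

section
/- (Convergence of SSO) Under the hypotheses that the space decomposition V = V₁ + ⋯ + V_N satisfies (SS1) with constant C_A and (SS2) with constant C_S and E satisfies (E1), one iteration of the SSO method starting from u^k ∈ B (producing u^{k+1} = v_N with e_i ∈ V_i the exact minimizer of each energy section) satisfies E(u^{k+1}) − E(u) ≤ ρ (E(u^k) − E(u)) with ρ = C_S² C_A²/(C_S² C_A² + μ²), where u is the global minimizer of E. -/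
theorem sso_tele (N : ℕ) : ∀ (F : Fin (N + 1) → ℝ) (i : Fin N),
    ∑ j ∈ Finset.univ.filter (fun j => i < j), (F j.succ - F j.castSucc) =
      F (Fin.last N) - F i.succ := by
  induction N with
  | zero => intro F i; exact i.elim0
  | succ n ih =>
    intro F i
    rw [Finset.sum_filter, Fin.sum_univ_castSucc]
    refine Fin.lastCases ?_ (fun i => ?_) i
    · have h : ∀ x : Fin n, ¬ (Fin.last n < x.castSucc) := fun x => not_lt.2 (Fin.le_last _)
      simp [h]
    · have := ih (fun k => F k.castSucc) i
      rw [Finset.sum_filter] at this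
      simp only [Fin.castSucc_lt_castSucc_iff, Fin.castSucc_lt_last, if_true]
      simp only [Fin.succ_castSucc, Fin.succ_last] at this ⊢
      rw [this]; ring

theorem sso_strong {V : Type*} [NormedAddCommGroup V] [InnerProductSpace ℝ V]
    (E : V → ℝ) (E' : V → V →L[ℝ] ℝ)
    (hdiff : ∀ v : V, HasFDerivAt E (E' v) v)
    (μ : ℝ)
    (hE1 : ∀ v w : V, μ * ‖w - v‖ ^ 2 ≤ E' w (w - v) - E' v (w - v)) (y d : V) :
    E y + E' y d + μ / 2 * ‖d‖ ^ 2 ≤ E (y + d) := by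
  have hg : ∀ t : ℝ, HasDerivAt
      (fun t : ℝ => E (y + t • d) - t * E' y d - μ / 2 * ‖d‖ ^ 2 * t ^ 2)
      (E' (y + t • d) d - E' y d - μ * ‖d‖ ^ 2 * t) t := by
    intro t
    have h1 : HasDerivAt (fun t : ℝ => y + t • d) d t := by
      simpa using ((hasDerivAt_id t).smul_const d).const_add y
    have h2 := (hdiff (y + t • d)).comp_hasDerivAt t h1
    have h3 := (hasDerivAt_id t).mul_const (E' y d)
    have h4 := (hasDerivAt_pow 2 t).const_mul (μ / 2 * ‖d‖ ^ 2)
    refine ((h2.sub h3).sub h4).congr_deriv ?_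
    simp; ring
  have hm : MonotoneOn (fun t : ℝ => E (y + t • d) - t * E' y d - μ / 2 * ‖d‖ ^ 2 * t ^ 2)
      (Set.Icc 0 1) := by
    refine monotoneOn_of_deriv_nonneg (convex_Icc 0 1)
      (fun t _ => (hg t).continuousAt.continuousWithinAt)
      (fun t _ => (hg t).differentiableAt.differentiableWithinAt) ?_
    intro t ht
    rw [interior_Icc] at ht
    rw [(hg t).deriv]
    have h := hE1 y (y + t • d)
    have ht0 : 0 < t := ht.1
    simp only [add_sub_cancel_left, norm_smul, map_smul, smul_eq_mul, Real.norm_eq_abs,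
      abs_of_pos ht0] at h
    by_contra hc
    push Not at hc
    nlinarith [mul_neg_of_pos_of_neg ht0 hc]
  have := hm (Set.left_mem_Icc.2 zero_le_one) (Set.right_mem_Icc.2 zero_le_one) zero_le_one
  simp at this
  linarith

theorem sso_seg {V : Type*} [NormedAddCommGroup V] [InnerProductSpace ℝ V]
    (E : V → ℝ) (E' : V → V →L[ℝ] ℝ) (μ : ℝ) (hμ : 0 < μ)
    (hs : ∀ y d : V, E y + E' y d + μ / 2 * ‖d‖ ^ 2 ≤ E (y + d))
    (a d : V) (t M : ℝ) (h0 : 0 ≤ t) (h1 : t ≤ 1) (ha : E a ≤ M) (hb : E (a + d) ≤ M) :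
    E (a + t • d) ≤ M := by
  have e1 := hs (a + t • d) (-(t • d))
  have e2 := hs (a + t • d) ((1 - t) • d)
  have q1 : a + t • d + -(t • d) = a := by abel
  have q2 : a + t • d + (1 - t) • d = a + d := by module
  rw [q1] at e1
  rw [q2] at e2
  simp only [map_neg, map_smul, smul_eq_mul] at e1 e2
  have p1 : 0 ≤ μ / 2 * ‖-(t • d)‖ ^ 2 := by positivity
  have p2 : 0 ≤ μ / 2 * ‖(1 - t) • d‖ ^ 2 := by positivity
  have f1 : E (a + t • d) - t * E' (a + t • d) d ≤ M := by linarith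
  have f2 : E (a + t • d) + (1 - t) * E' (a + t • d) d ≤ M := by linarith
  nlinarith [mul_le_mul_of_nonneg_left f1 (sub_nonneg.2 h1), mul_le_mul_of_nonneg_left f2 h0]


/-- Convergence of SSO: under (E1), (SS1) and (SS2), one SSO iteration contracts
the optimality gap with factor ρ = C_S² C_A² / (C_S² C_A² + μ²). -/
theorem stmt_9
    {V : Type*} [NormedAddCommGroup V] [InnerProductSpace ℝ V] [CompleteSpace V]
    (E : V → ℝ) (E' : V → V →L[ℝ] ℝ)
    (hdiff : ∀ v : V, HasFDerivAt E (E' v) v)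
    (μ : ℝ) (hμ : 0 < μ)
    (hE1 : ∀ v w : V, μ * ‖w - v‖ ^ 2 ≤ E' w (w - v) - E' v (w - v))
    (u₀ : V)
    (N : ℕ) (Vsub : Fin N → Submodule ℝ V)
    (hclosed : ∀ i, IsClosed ((Vsub i : Set V)))
    (CA CS : ℝ) (hCA : 0 < CA) (hCS : 0 < CS)
    (hSS1 : ∀ x : V, ∃ c : Fin N → V, (∀ i, c i ∈ Vsub i) ∧ x = ∑ i, c i ∧
      ∑ i, ‖c i‖ ^ 2 ≤ CA ^ 2 * ‖x‖ ^ 2)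
    (hSS2 : ∀ (w : Fin N → Fin N → V) (uu vv : Fin N → V),
      (∀ i j, E (w i j) ≤ E u₀) → (∀ i, uu i ∈ Vsub i) → (∀ i, vv i ∈ Vsub i) →
      (∀ i j, E (w i j + uu i) ≤ E u₀) →
      ∑ i, ∑ j ∈ Finset.univ.filter (fun j => i < j),
          (E' (w i j + uu j) (vv i) - E' (w i j) (vv i)) ≤
        CS * Real.sqrt (∑ i, ‖uu i‖ ^ 2) * Real.sqrt (∑ i, ‖vv i‖ ^ 2))
    (u : V) (hu : ∀ x : V, E u ≤ E x)
    (v : Fin (N + 1) → V) (hv0 : E (v 0) ≤ E u₀)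
    (e : Fin N → V)
    (he : ∀ i, e i ∈ Vsub i)
    (hmin : ∀ i, ∀ w ∈ Vsub i, E (v i.castSucc + e i) ≤ E (v i.castSucc + w))
    (hstep : ∀ i, v i.succ = v i.castSucc + e i) :
    E (v (Fin.last N)) - E u ≤
      CS ^ 2 * CA ^ 2 / (CS ^ 2 * CA ^ 2 + μ ^ 2) * (E (v 0) - E u) := by
  have hs := sso_strong E E' hdiff μ hE1
  have hcont : Continuous E := continuous_iff_continuousAt.2 fun x => (hdiff x).continuousAt
  -- first-order optimality
  have hopt : ∀ i, ∀ c ∈ Vsub i, E' (v i.succ) c = 0 := by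
    intro i c hc
    have h1 : HasDerivAt (fun t : ℝ => v i.succ + t • c) c 0 := by
      simpa using ((hasDerivAt_id (0:ℝ)).smul_const c).const_add (v i.succ)
    have h2 : HasDerivAt (fun t : ℝ => E (v i.succ + t • c)) (E' (v i.succ) c) 0 := by
      have h3 : HasFDerivAt E (E' (v i.succ)) (v i.succ + (0:ℝ) • c) := by
        simpa using hdiff (v i.succ)
      exact h3.comp_hasDerivAt 0 h1
    refine IsLocalMin.hasDerivAt_eq_zero (Filter.Eventually.of_forall fun t => ?_) h2
    have := hmin i (e i + t • c) ((Vsub i).add_mem (he i) ((Vsub i).smul_mem t hc))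
    simpa [hstep i, add_assoc] using this
  have hdec : ∀ i, μ / 2 * ‖e i‖ ^ 2 ≤ E (v i.castSucc) - E (v i.succ) := by
    intro i
    have h := hs (v i.succ) (-(e i))
    have q : v i.succ + -(e i) = v i.castSucc := by rw [hstep i]; abel
    rw [q, map_neg, hopt i _ (he i), norm_neg] at h
    linarith
  have hanti : Antitone (fun k => E (v k)) := by
    rw [Fin.antitone_iff_succ_le]
    intro i
    have : 0 ≤ μ / 2 * ‖e i‖ ^ 2 := by positivity
    linarith [hdec i]
  have hB : ∀ k, E (v k) ≤ E u₀ := fun k => (hanti (Fin.zero_le k)).trans hv0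
  have hsum : μ / 2 * ∑ i, ‖e i‖ ^ 2 ≤ E (v 0) - E (v (Fin.last N)) := by
    have ht : ∀ (n : ℕ) (F : Fin (n + 1) → ℝ),
        ∑ i : Fin n, (F i.castSucc - F i.succ) = F 0 - F (Fin.last n) := by
      intro n
      induction n with
      | zero => intro F; simp
      | succ n ih =>
        intro F
        rw [Fin.sum_univ_castSucc]
        have := ih (fun k => F k.castSucc)
        simp only [Fin.succ_castSucc, Fin.succ_last, Fin.castSucc_zero] at this ⊢
        rw [this]; ring
    rw [Finset.mul_sum, ← ht N (fun k => E (v k))]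
    exact Finset.sum_le_sum fun i _ => hdec i
  have hK : 0 < CS ^ 2 * CA ^ 2 := by positivity
  rcases (hu u₀).eq_or_lt with heq | hlt
  · have h1 : E (v (Fin.last N)) - E u ≤ 0 := by linarith [hB (Fin.last N)]
    have h2 : 0 ≤ E (v 0) - E u := by linarith [hu (v 0)]
    exact h1.trans (by positivity)
  obtain ⟨c, hc, hcs, hcn⟩ := hSS1 (v (Fin.last N) - u)
  -- perturbation
  have hsm : ∀ (x y : V), E x < E u₀ →
      ∀ᶠ n : ℕ in Filter.atTop, E (x + (1 / ((n : ℝ) + 1)) • y) ≤ E u₀ := by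
    intro x y hx
    have h1 : Filter.Tendsto (fun n : ℕ => E (x + (1 / ((n : ℝ) + 1)) • y)) Filter.atTop
        (nhds (E (x + (0:ℝ) • y))) := by
      refine (hcont.tendsto _).comp ?_
      exact tendsto_const_nhds.add ((tendsto_one_div_add_atTop_nhds_zero_nat).smul_const y)
    rw [zero_smul, add_zero] at h1
    exact (h1.eventually (gt_mem_nhds hx)).mono fun n hn => le_of_lt hn
  have hsm2 : ∀ (i : Fin N) (k : Fin (N + 1)), i.succ ≤ k →
      ∀ᶠ n : ℕ in Filter.atTop, E (v k + (1 / ((n : ℝ) + 1)) • e i) ≤ E u₀ := by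
    intro i k hik
    by_cases h0 : e i = 0
    · refine Filter.Eventually.of_forall fun n => ?_
      rw [h0, smul_zero, add_zero]; exact hB k
    · apply hsm
      have : 0 < μ / 2 * ‖e i‖ ^ 2 := by
        have := norm_pos_iff.2 h0
        positivity
      have h2 : E (v k) ≤ E (v i.succ) := hanti hik
      linarith [hdec i, hB i.castSucc]
  have hev : ∀ᶠ n : ℕ in Filter.atTop,
      (∀ i : Fin N, E (u + (1 / ((n : ℝ) + 1)) • e i) ≤ E u₀) ∧
      (∀ (i : Fin N) (k : Fin (N + 1)), i.succ ≤ k →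
        E (v k + (1 / ((n : ℝ) + 1)) • e i) ≤ E u₀) := by
    refine Filter.Eventually.and ?_ ?_
    · rw [Filter.eventually_all]; exact fun i => hsm u _ hlt
    · simp only [Filter.eventually_all]; exact hsm2
  obtain ⟨n, hn1, hn2⟩ := hev.exists
  have hnpos : (0:ℝ) < (n : ℝ) + 1 := by positivity
  have hkey : ∑ i, ∑ j ∈ Finset.univ.filter (fun j => i < j),
      (E' (v j.succ) (c i) - E' (v j.castSucc) (c i)) ≤
        CS * Real.sqrt (∑ i, ‖e i‖ ^ 2) * Real.sqrt (∑ i, ‖c i‖ ^ 2) := by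
    have hk : ∀ k ∈ Finset.range (n + 1),
        ∑ i, ∑ j ∈ Finset.univ.filter (fun j => i < j),
          (E' (v j.castSucc + (((k + 1 : ℕ) : ℝ) / ((n : ℝ) + 1)) • e j) (c i)
            - E' (v j.castSucc + ((k : ℝ) / ((n : ℝ) + 1)) • e j) (c i)) ≤
        (1 / ((n : ℝ) + 1)) *
          (CS * Real.sqrt (∑ i, ‖e i‖ ^ 2) * Real.sqrt (∑ i, ‖c i‖ ^ 2)) := by
      intro k hk
      have hkn : (k : ℝ) ≤ (n : ℝ) + 1 := by
        have := Finset.mem_range.1 hk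
        exact_mod_cast this.le
      have ht0 : 0 ≤ (k : ℝ) / ((n : ℝ) + 1) := by positivity
      have ht1 : (k : ℝ) / ((n : ℝ) + 1) ≤ 1 := (div_le_one hnpos).2 hkn
      have h := hSS2 (fun i j => if i < j then v j.castSucc + ((k : ℝ) / ((n : ℝ) + 1)) • e j
          else u) (fun i => (1 / ((n : ℝ) + 1)) • e i) c ?_
          (fun i => (Vsub i).smul_mem _ (he i)) hc ?_
      · have hq : Real.sqrt (∑ i, ‖(1 / ((n : ℝ) + 1)) • e i‖ ^ 2) =
            (1 / ((n : ℝ) + 1)) * Real.sqrt (∑ i, ‖e i‖ ^ 2) := by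
          have hp : 0 ≤ 1 / ((n : ℝ) + 1) := by positivity
          simp only [norm_smul, mul_pow, Real.norm_eq_abs, abs_of_nonneg hp]
          rw [← Finset.mul_sum, Real.sqrt_mul (by positivity), Real.sqrt_sq hp]
        rw [hq] at h
        refine le_trans (le_of_eq ?_) (h.trans (le_of_eq (by ring)))
        refine Finset.sum_congr rfl fun i _ => Finset.sum_congr rfl fun j hj => ?_
        have hij := (Finset.mem_filter.1 hj).2
        simp only [if_pos hij, add_assoc, ← add_smul]
        rw [← add_div]; push_cast; rfl
      · intro i j
        split_ifs with hij
        · refine sso_seg E E' μ hμ hs _ _ _ _ ht0 ht1 (hB _) ?_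
          rw [← hstep]; exact hB _
        · exact hlt.le
      · intro i j
        split_ifs with hij
        · rw [add_right_comm]
          refine sso_seg E E' μ hμ hs _ _ _ _ ht0 ht1 (hn2 i _ ?_) ?_
          · rw [Fin.le_def]; simpa using hij
          · rw [add_right_comm, ← hstep]
            refine hn2 i _ ?_
            rw [Fin.le_def]; simpa using Fin.le_def.1 hij.le
        · exact hn1 i
    have h := Finset.sum_le_sum hk
    rw [Finset.sum_const, Finset.card_range, nsmul_eq_mul, Finset.sum_comm] at h
    have hr : ((n + 1 : ℕ) : ℝ) * (1 / ((n : ℝ) + 1) *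
        (CS * Real.sqrt (∑ i, ‖e i‖ ^ 2) * Real.sqrt (∑ i, ‖c i‖ ^ 2))) =
        CS * Real.sqrt (∑ i, ‖e i‖ ^ 2) * Real.sqrt (∑ i, ‖c i‖ ^ 2) := by
      push_cast; field_simp
    rw [hr] at h
    refine le_trans (le_of_eq ?_) h
    refine Finset.sum_congr rfl fun i _ => ?_
    rw [Finset.sum_comm]
    refine Finset.sum_congr rfl fun j _ => ?_
    rw [Finset.sum_range_sub
      (fun k : ℕ => E' (v j.castSucc + ((k : ℝ) / ((n : ℝ) + 1)) • e j) (c i))]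
    have hone : ((n + 1 : ℕ) : ℝ) / ((n : ℝ) + 1) = 1 := by
      push_cast; exact div_self hnpos.ne'
    rw [hone, one_smul, ← hstep]
    simp
  have hlhs : E' (v (Fin.last N)) (v (Fin.last N) - u) =
      ∑ i, ∑ j ∈ Finset.univ.filter (fun j => i < j),
      (E' (v j.succ) (c i) - E' (v j.castSucc) (c i)) := by
    conv_lhs => rw [hcs, map_sum]
    refine Finset.sum_congr rfl fun i _ => ?_
    rw [sso_tele N (fun k => E' (v k) (c i)) i, hopt i _ (hc i), sub_zero]
  rw [← hlhs] at hkey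
  have hfin := hs (v (Fin.last N)) (-(v (Fin.last N) - u))
  rw [map_neg, norm_neg, show v (Fin.last N) + -(v (Fin.last N) - u) = u by abel] at hfin
  set D := ‖v (Fin.last N) - u‖ with hD
  set S := Real.sqrt (∑ i, ‖e i‖ ^ 2) with hS
  have hS2 : S ^ 2 = ∑ i, ‖e i‖ ^ 2 := Real.sq_sqrt (by positivity)
  have hS0 : 0 ≤ S := Real.sqrt_nonneg _
  have hD0 : 0 ≤ D := norm_nonneg _
  have hcn' : Real.sqrt (∑ i, ‖c i‖ ^ 2) ≤ CA * D := by
    apply Real.sqrt_le_iff.2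
    exact ⟨by positivity, by rw [mul_pow]; exact hcn⟩
  have hb : E' (v (Fin.last N)) (v (Fin.last N) - u) ≤ CS * S * (CA * D) :=
    hkey.trans (mul_le_mul_of_nonneg_left hcn' (by positivity))
  rw [← hS2] at hsum
  set gN := E (v (Fin.last N)) - E u with hgN
  have hg : gN ≤ CS * S * (CA * D) - μ / 2 * D ^ 2 := by linarith
  have h2 : 2 * μ * gN ≤ CS ^ 2 * CA ^ 2 * S ^ 2 := by
    nlinarith [sq_nonneg (CS * CA * S - μ * D)]
  have h3 : μ ^ 2 * gN ≤ CS ^ 2 * CA ^ 2 * ((E (v 0) - E u) - gN) := by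
    have a1 := mul_le_mul_of_nonneg_left hsum hK.le
    have a2 := mul_le_mul_of_nonneg_left h2 hμ.le
    have a3 : (E (v 0) - E u) - gN = E (v 0) - E (v (Fin.last N)) := by rw [hgN]; ring
    rw [a3]
    nlinarith
  rw [div_mul_eq_mul_div, le_div_iff₀ (by positivity)]
  linarith
end

section
/- (Properties of the one-dimensional energy section) Assume E satisfies (E1)–(E2). Fix v ∈ B and s ∈ V with ⟨E'(v), s⟩ < 0, and define f(α) := E(v + αs) for α ∈ ℝ. Then f is differentiable; f is strongly convex in the sense that (f'(α) − f'(β))(α − β) ≥ μ (α − β)² ‖s‖² for all α, β ∈ ℝ; and if α* denotes the global minimizer of f, then α* > 0 and f' is Lipschitz on [0, α_L] with α_L := (1 + √(μ/L)) α*, i.e., |f'(α) − f'(β)| ≤ L ‖s‖² |α − β| for all 0 ≤ α, β ≤ α_L. -/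
theorem aux_quad (f f' : ℝ → ℝ) (hf : ∀ x, HasDerivAt f (f' x) x) (K A x y : ℝ) (hxy : x ≤ y)
    (h : ∀ z, x < z → z < y → f' z ≤ K * (z - A)) :
    f y - f x ≤ K / 2 * ((y - A) ^ 2 - (x - A) ^ 2) := by
  have hd : ∀ z, HasDerivAt (fun t => f t - K / 2 * (t - A) ^ 2) (f' z - K * (z - A)) z := by
    intro z
    have h1 := (((hasDerivAt_id z).sub_const A).pow 2).const_mul (K / 2)
    have h2 := (hf z).sub h1
    refine h2.congr_deriv ?_
    simp only [id, Nat.cast_ofNat]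
    ring
  have hanti : AntitoneOn (fun t => f t - K / 2 * (t - A) ^ 2) (Set.Icc x y) := by
    apply antitoneOn_of_deriv_nonpos (convex_Icc x y)
    · exact fun z _ => (hd z).continuousAt.continuousWithinAt
    · exact fun z _ => (hd z).differentiableAt.differentiableWithinAt
    · intro z hz
      rw [interior_Icc] at hz
      rw [(hd z).deriv]
      linarith [h z hz.1 hz.2]
  have := hanti (Set.left_mem_Icc.2 hxy) (Set.right_mem_Icc.2 hxy) hxy
  simp only at this
  linarith

/-- Properties of the one-dimensional energy section f(α) = E(v + αs):
differentiability, strong convexity, positivity of the exact line-search minimizer α*, and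
Lipschitz continuity of f' on [0, (1 + √(μ/L)) α*]. -/
theorem stmt_12
    {V : Type*} [NormedAddCommGroup V] [InnerProductSpace ℝ V] [CompleteSpace V]
    (E : V → ℝ) (E' : V → V →L[ℝ] ℝ)
    (hdiff : ∀ v : V, HasFDerivAt E (E' v) v)
    (μ : ℝ) (hμ : 0 < μ)
    (hE1 : ∀ v w : V, μ * ‖w - v‖ ^ 2 ≤ E' w (w - v) - E' v (w - v))
    (u₀ : V) (L : ℝ) (hL : 0 < L)
    (hE2 : ∀ v ∈ {x : V | E x ≤ E u₀}, ∀ w ∈ {x : V | E x ≤ E u₀},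
      ‖E' w - E' v‖ ≤ L * ‖w - v‖)
    (v s : V) (hv : E v ≤ E u₀) (hdesc : E' v s < 0)
    (αstar : ℝ) (hmin : ∀ α : ℝ, E (v + αstar • s) ≤ E (v + α • s)) :
    Differentiable ℝ (fun α : ℝ => E (v + α • s)) ∧
    (∀ α : ℝ, HasDerivAt (fun β : ℝ => E (v + β • s)) (E' (v + α • s) s) α) ∧
    (∀ α β : ℝ, μ * (α - β) ^ 2 * ‖s‖ ^ 2 ≤
      (E' (v + α • s) s - E' (v + β • s) s) * (α - β)) ∧
    0 < αstar ∧
    (∀ α β : ℝ, 0 ≤ α → α ≤ (1 + Real.sqrt (μ / L)) * αstar →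
      0 ≤ β → β ≤ (1 + Real.sqrt (μ / L)) * αstar →
      |E' (v + α • s) s - E' (v + β • s) s| ≤ L * ‖s‖ ^ 2 * |α - β|) := by
  have hd : ∀ α : ℝ, HasDerivAt (fun β : ℝ => E (v + β • s)) (E' (v + α • s) s) α := by
    intro α
    have h1 : HasDerivAt (fun β : ℝ => v + β • s) s α := by
      simpa using ((hasDerivAt_id α).smul_const s).const_add v
    exact (hdiff (v + α • s)).comp_hasDerivAt α h1
  have hsub : ∀ α β : ℝ, (v + α • s) - (v + β • s) = (α - β) • s := by
    intro α β
    rw [sub_smul]; abel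
  have hsc : ∀ α β : ℝ, μ * (α - β) ^ 2 * ‖s‖ ^ 2 ≤
      (E' (v + α • s) s - E' (v + β • s) s) * (α - β) := by
    intro α β
    have h := hE1 (v + β • s) (v + α • s)
    rw [hsub, norm_smul, mul_pow, Real.norm_eq_abs, sq_abs, map_smul, map_smul, smul_eq_mul,
      smul_eq_mul] at h
    linarith
  have hLip : ∀ α β : ℝ, E (v + α • s) ≤ E u₀ → E (v + β • s) ≤ E u₀ →
      |E' (v + α • s) s - E' (v + β • s) s| ≤ L * ‖s‖ ^ 2 * |α - β| := by
    intro α β ha hb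
    have h := hE2 (v + β • s) hb (v + α • s) ha
    rw [hsub, norm_smul, Real.norm_eq_abs] at h
    have h2 := (E' (v + α • s) - E' (v + β • s)).le_opNorm s
    rw [Real.norm_eq_abs] at h2
    have h3 := mul_le_mul_of_nonneg_right h (norm_nonneg s)
    calc _ ≤ _ := h2
      _ ≤ _ := h3
      _ = _ := by ring
  have hs : 0 < ‖s‖ ^ 2 := by
    have : s ≠ 0 := by
      rintro rfl
      simp at hdesc
    have := norm_pos_iff.2 this
    positivity
  have hf0 : E' (v + (0:ℝ) • s) s < 0 := by simpa using hdesc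
  have hfv : E (v + (0:ℝ) • s) ≤ E u₀ := by simpa using hv
  have hfA : E' (v + αstar • s) s = 0 :=
    IsLocalMin.hasDerivAt_eq_zero (Filter.Eventually.of_forall hmin) (hd αstar)
  clear hdiff hE1 hE2 hsub hdesc hv
  have hcont : Continuous (fun α : ℝ => E (v + α • s)) :=
    continuous_iff_continuousAt.2 fun x => (hd x).continuousAt
  generalize ‖s‖ ^ 2 = M at *
  obtain ⟨f, hf⟩ : ∃ f : ℝ → ℝ, f = fun α => E (v + α • s) := ⟨_, rfl⟩
  obtain ⟨g, hg⟩ : ∃ g : ℝ → ℝ, g = fun α => E' (v + α • s) s := ⟨_, rfl⟩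
  have hfe : ∀ α, E (v + α • s) = f α := fun α => by rw [hf]
  have hge : ∀ α, E' (v + α • s) s = g α := fun α => by rw [hg]
  simp only [hfe, hge] at *
  clear hf hg hfe hge
  have hμM : 0 < μ * M := by positivity
  have hApos : 0 < αstar := by
    have h := hsc αstar 0
    rw [hfA] at h
    have h2 : 0 ≤ μ * (αstar - 0) ^ 2 * M := by positivity
    have h3 : 0 ≤ (-g 0) * αstar := by linarith
    have h4 : 0 ≤ αstar := nonneg_of_mul_nonneg_right h3 (by linarith)
    rcases h4.lt_or_eq with h5 | h5
    · exact h5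
    · rw [← h5] at hfA; linarith
  have hneg : ∀ z, z < αstar → g z ≤ μ * M * (z - αstar) := by
    intro z hz
    have h := hsc z αstar
    rw [hfA] at h
    by_contra hc
    push Not at hc
    nlinarith [mul_pos (sub_pos.2 hc) (sub_pos.2 hz)]
  have hpos : ∀ z, αstar ≤ z → 0 ≤ g z := by
    intro z hz
    rcases hz.lt_or_eq with hz | rfl
    · have h := hsc z αstar
      rw [hfA] at h
      have h2 : 0 ≤ μ * (z - αstar) ^ 2 * M := by positivity
      have h3 : 0 ≤ (z - αstar) * g z := by linarith
      exact nonneg_of_mul_nonneg_right h3 (by linarith)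
    · exact hfA.ge
  have hmono : MonotoneOn f (Set.Ici αstar) := by
    apply monotoneOn_of_deriv_nonneg (convex_Ici _) hcont.continuousOn
    · exact fun z _ => (hd z).differentiableAt.differentiableWithinAt
    · intro z hz
      rw [interior_Ici] at hz
      rw [(hd z).deriv]
      exact hpos z (le_of_lt hz)
  have hleft : ∀ z, 0 ≤ z → z ≤ αstar → f z ≤ f 0 := by
    intro z h0 hz
    have := aux_quad f g hd 0 0 0 z h0 (fun t _ ht => by
      have h1 := hneg t (by linarith)
      nlinarith)
    linarith
  have hlow := aux_quad f g hd (μ * M) αstar 0 αstar hApos.le (fun t _ ht => hneg t ht)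
  have hc : αstar ≤ (1 + Real.sqrt (μ / L)) * αstar := by
    nlinarith [Real.sqrt_nonneg (μ / L)]
  have hcsq : L * ((1 + Real.sqrt (μ / L)) * αstar - αstar) ^ 2 = μ * αstar ^ 2 := by
    have h := Real.sq_sqrt (show 0 ≤ μ / L by positivity)
    have : ((1 + Real.sqrt (μ / L)) * αstar - αstar) ^ 2
        = Real.sqrt (μ / L) ^ 2 * αstar ^ 2 := by ring
    rw [this, h]
    field_simp
  generalize (1 + Real.sqrt (μ / L)) * αstar = c at *
  have hfc : f c ≤ f 0 := by
    by_contra hcon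
    push Not at hcon
    obtain ⟨T, hT, hTe⟩ := intermediate_value_Icc hc hcont.continuousOn
      (show f 0 ∈ Set.Icc (f αstar) (f c) from ⟨hmin 0, hcon.le⟩)
    have hTc : T < c := by
      rcases hT.2.lt_or_eq with h | h
      · exact h
      · rw [h] at hTe; linarith
    have hup := aux_quad f g hd (L * M) αstar αstar T hT.1 (fun t h1 h2 => by
      have h3 : f t ≤ f T := hmono h1.le hT.1 h2.le
      have h := hLip t αstar (by linarith) (by linarith [hmin 0])
      rw [hfA, sub_zero, abs_of_pos (sub_pos.2 h1)] at h
      exact (le_abs_self _).trans h)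
    have h5 : (T - αstar) ^ 2 < (c - αstar) ^ 2 := by
      have := hT.1
      nlinarith
    have h6 : L * M * (T - αstar) ^ 2 < L * M * (c - αstar) ^ 2 :=
      mul_lt_mul_of_pos_left h5 (by positivity)
    have h7 : L * M * (c - αstar) ^ 2 = μ * M * αstar ^ 2 := by
      linear_combination M * hcsq
    nlinarith
  have hall : ∀ z, 0 ≤ z → z ≤ c → f z ≤ E u₀ := by
    intro z h0 hz
    rcases le_total z αstar with h | h
    · exact (hleft z h0 h).trans hfv
    · exact ((hmono h hc hz).trans hfc).trans hfv
  exact ⟨fun x => (hd x).differentiableAt, hd, hsc, hApos,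
    fun α β h1 h2 h3 h4 => hLip α β (hall α h1 h2) (hall β h3 h4)⟩
end

section
/- (Lower bound on the exact step size) Assume E satisfies (E1)–(E2), V_i is a closed subspace of V, and E_i : V_i → ℝ satisfies the strong convexity assumption (E3) with constant μ_i > 0. Suppose v ∈ B, ξ ∈ V_i, s ∈ V_i with s ≠ 0 satisfy ⟨E_i'(ξ + s) − E_i'(ξ), w⟩ = −⟨E'(v), w⟩ for all w ∈ V_i, and let α* be the global minimizer of α ↦ E(v + αs) over ℝ. Then α* ≥ μ_i/L > 0. -/
/-- Lower bound on the exact step size: the exact line-search step size α* in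
the FASD method satisfies α* ≥ μ_i / L > 0. -/
theorem stmt_13
    {V : Type*} [NormedAddCommGroup V] [InnerProductSpace ℝ V] [CompleteSpace V]
    (E : V → ℝ) (E' : V → V →L[ℝ] ℝ)
    (hdiff : ∀ v : V, HasFDerivAt E (E' v) v)
    (μ : ℝ) (hμ : 0 < μ)
    (hE1 : ∀ v w : V, μ * ‖w - v‖ ^ 2 ≤ E' w (w - v) - E' v (w - v))
    (u₀ : V) (L : ℝ) (hL : 0 < L)
    (hE2 : ∀ v ∈ {x : V | E x ≤ E u₀}, ∀ w ∈ {x : V | E x ≤ E u₀},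
      ‖E' w - E' v‖ ≤ L * ‖w - v‖)
    (Vi : Submodule ℝ V) (hclosed : IsClosed ((Vi : Set V)))
    (Ei : V → ℝ) (Ei' : V → V →L[ℝ] ℝ)
    (hEidiff : ∀ x ∈ (Vi : Set V), HasFDerivWithinAt Ei (Ei' x) (Vi : Set V) x)
    (μi : ℝ) (hμi : 0 < μi)
    (hE3 : ∀ v ∈ Vi, ∀ w ∈ Vi, μi * ‖w - v‖ ^ 2 ≤ Ei' w (w - v) - Ei' v (w - v))
    (v : V) (hv : E v ≤ E u₀)
    (ξ s : V) (hξ : ξ ∈ Vi) (hsmem : s ∈ Vi) (hs0 : s ≠ 0)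
    (hres : ∀ w ∈ Vi, Ei' (ξ + s) w - Ei' ξ w = -(E' v w))
    (αstar : ℝ) (hmin : ∀ α : ℝ, E (v + αstar • s) ≤ E (v + α • s)) :
    μi / L ≤ αstar ∧ 0 < μi / L := by
  have hs : 0 < ‖s‖ := norm_pos_iff.mpr hs0
  have hs2 : 0 < ‖s‖ ^ 2 := by positivity
  have hcrit : E' (v + αstar • s) s = 0 := by
    have h1 : HasDerivAt (fun α : ℝ => v + α • s) s αstar := by
      simpa using ((hasDerivAt_id αstar).smul_const s).const_add v
    have h2 : HasDerivAt (fun α : ℝ => E (v + α • s)) (E' (v + αstar • s) s) αstar :=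
      (hdiff (v + αstar • s)).comp_hasDerivAt αstar h1
    exact IsLocalMin.hasDerivAt_eq_zero (Filter.Eventually.of_forall hmin) h2
  have hdesc : μi * ‖s‖ ^ 2 ≤ -(E' v s) := by
    have h := hE3 ξ hξ (ξ + s) (Vi.add_mem hξ hsmem)
    rw [add_sub_cancel_left, hres s hsmem] at h
    exact h
  have hpos : 0 < -(E' v s) := lt_of_lt_of_le (by positivity) hdesc
  have hα : 0 ≤ αstar := by
    have h := hE1 v (v + αstar • s)
    rw [add_sub_cancel_left, map_smul, map_smul, hcrit, smul_eq_mul, smul_eq_mul] at h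
    have h0 : 0 ≤ μ * ‖αstar • s‖ ^ 2 := by positivity
    by_contra hneg
    push Not at hneg
    nlinarith
  have hB : E (v + αstar • s) ≤ E u₀ := by
    have h := hmin 0
    rw [zero_smul, add_zero] at h
    exact h.trans hv
  have hLip := hE2 v hv (v + αstar • s) hB
  rw [add_sub_cancel_left, norm_smul, Real.norm_of_nonneg hα] at hLip
  have hop := (le_abs_self _).trans ((E' (v + αstar • s) - E' v).le_opNorm s)
  rw [ContinuousLinearMap.sub_apply, hcrit] at hop
  have hmul := mul_le_mul_of_nonneg_right hLip hs.le
  have hfin : μi * ‖s‖ ^ 2 ≤ (αstar * L) * ‖s‖ ^ 2 := by nlinarith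
  exact ⟨(div_le_iff₀ hL).mpr (le_of_mul_le_mul_right hfin hs2), div_pos hμi hL⟩
end

section
/- (FASD lower bound) Suppose E satisfies (E1). Let v₀ ∈ V and, for i = 1, …, N, let s_i ∈ V be any search direction, let α_i* be a global minimizer of α ↦ E(v_{i−1} + α s_i) over ℝ, set ε_i := α_i* s_i and v_i := v_{i−1} + ε_i. Then E(v₀) − E(v_N) ≥ (μ/2) Σ_{i=1}^N ‖ε_i‖². -/
theorem aux_line {V : Type*} [NormedAddCommGroup V] [InnerProductSpace ℝ V]
    (E : V → ℝ) (E' : V → V →L[ℝ] ℝ)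
    (hdiff : ∀ v : V, HasFDerivAt E (E' v) v) (w d : V) (t : ℝ) :
    HasDerivAt (fun t : ℝ => E (w + t • d)) (E' (w + t • d) d) t := by
  have h1 : HasDerivAt (fun t : ℝ => w + t • d) d t := by
    simpa using ((hasDerivAt_id t).smul_const d).const_add w
  exact (hdiff (w + t • d)).comp_hasDerivAt t h1

theorem aux_convex {V : Type*} [NormedAddCommGroup V] [InnerProductSpace ℝ V]
    (E : V → ℝ) (E' : V → V →L[ℝ] ℝ)
    (hdiff : ∀ v : V, HasFDerivAt E (E' v) v) (μ : ℝ)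
    (hE1 : ∀ v w : V, μ * ‖w - v‖ ^ 2 ≤ E' w (w - v) - E' v (w - v)) (w d : V) :
    E w + E' w d + μ / 2 * ‖d‖ ^ 2 ≤ E (w + d) := by
  have hg : ∀ t : ℝ, HasDerivAt
      (fun t : ℝ => E (w + t • d) - t * E' w d - μ / 2 * ‖d‖ ^ 2 * t ^ 2)
      (E' (w + t • d) d - E' w d - μ * ‖d‖ ^ 2 * t) t := by
    intro t
    have h := ((aux_line E E' hdiff w d t).sub ((hasDerivAt_id t).mul_const (E' w d))).sub
      ((hasDerivAt_pow 2 t).const_mul (μ / 2 * ‖d‖ ^ 2))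
    refine h.congr_deriv ?_
    norm_num
    ring
  have hm : MonotoneOn
      (fun t : ℝ => E (w + t • d) - t * E' w d - μ / 2 * ‖d‖ ^ 2 * t ^ 2) (Set.Ici 0) := by
    apply monotoneOn_of_deriv_nonneg (convex_Ici 0)
    · exact fun t _ => (hg t).continuousAt.continuousWithinAt
    · exact fun t _ => (hg t).differentiableAt.differentiableWithinAt
    · intro t ht
      rw [interior_Ici, Set.mem_Ioi] at ht
      rw [(hg t).deriv]
      have h := hE1 w (w + t • d)
      simp only [add_sub_cancel_left, map_smul, smul_eq_mul, norm_smul, mul_pow,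
        Real.norm_eq_abs, sq_abs] at h
      have h2 : 0 ≤ t * (E' (w + t • d) d - E' w d - μ * ‖d‖ ^ 2 * t) := by nlinarith
      exact nonneg_of_mul_nonneg_right h2 ht
  have h := hm (Set.mem_Ici.2 le_rfl) (Set.mem_Ici.2 zero_le_one) zero_le_one
  simp at h
  linarith

/-- FASD lower bound: one FASD iteration with exact line searches decreases the
energy by at least (μ/2) Σ ‖ε_i‖². -/
theorem stmt_14
    {V : Type*} [NormedAddCommGroup V] [InnerProductSpace ℝ V] [CompleteSpace V]
    (E : V → ℝ) (E' : V → V →L[ℝ] ℝ)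
    (hdiff : ∀ v : V, HasFDerivAt E (E' v) v)
    (μ : ℝ) (hμ : 0 < μ)
    (hE1 : ∀ v w : V, μ * ‖w - v‖ ^ 2 ≤ E' w (w - v) - E' v (w - v))
    (N : ℕ) (v : Fin (N + 1) → V) (s : Fin N → V) (αstar : Fin N → ℝ)
    (hmin : ∀ i, ∀ α : ℝ,
      E (v i.castSucc + αstar i • s i) ≤ E (v i.castSucc + α • s i))
    (ε : Fin N → V) (hε : ∀ i, ε i = αstar i • s i)
    (hstep : ∀ i, v i.succ = v i.castSucc + ε i) :
    μ / 2 * ∑ i, ‖ε i‖ ^ 2 ≤ E (v 0) - E (v (Fin.last N)) := by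
  have key : ∀ i, μ / 2 * ‖ε i‖ ^ 2 ≤ E (v i.castSucc) - E (v i.succ) := by
    intro i
    have h0 : E' (v i.succ) (-ε i) = 0 := by
      have hd := aux_line E E' hdiff (v i.succ) (-ε i) 0
      have hl : IsLocalMin (fun t : ℝ => E (v i.succ + t • (-ε i))) 0 := by
        refine Filter.Eventually.of_forall fun t => ?_
        have h := hmin i (αstar i - t * αstar i)
        have e : v i.succ + t • (-ε i) = v i.castSucc + (αstar i - t * αstar i) • s i := by
          rw [hstep, hε]
          module
        simp only [e, zero_smul, add_zero]
        rw [hstep, hε]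
        exact h
      have := hl.hasDerivAt_eq_zero hd
      simpa using this
    have h := aux_convex E E' hdiff μ hE1 (v i.succ) (-ε i)
    have e : v i.succ + -ε i = v i.castSucc := by
      rw [hstep]
      abel
    rw [e, h0, norm_neg] at h
    linarith
  have h1 := Fin.sum_univ_castSucc (fun i => E (v i))
  have h2 := Fin.sum_univ_succ (fun i => E (v i))
  have h3 := Finset.sum_le_sum (fun i (_ : i ∈ Finset.univ) => key i)
  rw [Finset.sum_sub_distrib, ← Finset.mul_sum] at h3
  linarith
end

section
/- (FASD-ALS lower bound) Suppose E satisfies (E1)–(E2) and each local energy E_i : V_i → ℝ (V_i a closed subspace) satisfies (E3) with constant μ_i > 0. Let u^k = v₀ ∈ B and, for i = 1, …, N: ξ_i := Q_i v_{i−1} for a linear projection Q_i : V → V_i; η_i ∈ V_i solves ⟨E_i'(η_i), w⟩ = ⟨E_i'(ξ_i) − E'(v_{i−1}), w⟩ for all w ∈ V_i; s_i := η_i − ξ_i ≠ 0; α_i^q := −⟨E'(v_{i−1}), s_i⟩/(L‖s_i‖²); v_i := v_{i−1} + α_i^q s_i; and u^{k+1} := v_N. Then E(u^k) − E(u^{k+1})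 ≥ (L/2) Σ_{i=1}^N ‖α_i^q s_i‖². -/
theorem step_aux {V : Type*} [NormedAddCommGroup V] [InnerProductSpace ℝ V]
    (E : V → ℝ) (E' : V → V →L[ℝ] ℝ)
    (hdiff : ∀ v : V, HasFDerivAt E (E' v) v)
    (L : ℝ) (hL : 0 < L) (u₀ : V)
    (hE2 : ∀ v ∈ {x : V | E x ≤ E u₀}, ∀ w ∈ {x : V | E x ≤ E u₀},
      ‖E' w - E' v‖ ≤ L * ‖w - v‖)
    (x d : V) (hx : E x ≤ E u₀) (hd : E' x d = -(L * ‖d‖ ^ 2)) :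
    L / 2 * ‖d‖ ^ 2 ≤ E x - E (x + d) := by
  by_cases hd0 : d = 0
  · simp [hd0]
  have hc : 0 < L * ‖d‖ ^ 2 := by
    have := norm_pos_iff.mpr hd0
    positivity
  have hφ : ∀ t : ℝ, HasDerivAt (fun t : ℝ => E (x + t • d)) (E' (x + t • d) d) t := by
    intro t
    have h1 : HasDerivAt (fun t : ℝ => x + t • d) d t := by
      simpa using ((hasDerivAt_id t).smul_const d).const_add x
    exact (hdiff (x + t • d)).comp_hasDerivAt t h1
  have hcont : ContinuousOn (fun t : ℝ => E (x + t • d)) (Set.Icc 0 1) :=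
    fun t _ => (hφ t).continuousAt.continuousWithinAt
  have hder : ∀ t : ℝ, 0 ≤ t → E (x + t • d) ≤ E x →
      E' (x + t • d) d ≤ -((1 - t) * (L * ‖d‖ ^ 2)) := by
    intro t ht h
    have h1 := hE2 x hx (x + t • d) (le_trans h hx)
    have h2 := (E' (x + t • d) - E' x).le_opNorm d
    have h3 := le_trans (le_abs_self _) h2
    rw [add_sub_cancel_left, norm_smul, Real.norm_of_nonneg ht] at h1
    have h4 := mul_le_mul_of_nonneg_right h1 (norm_nonneg d)
    rw [sub_apply, hd] at h3
    linarith
  have hB : ∀ ⦃t : ℝ⦄, t ∈ Set.Icc (0 : ℝ) 1 → E (x + t • d) ≤ E x := by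
    refine image_le_of_deriv_right_lt_deriv_boundary (B := fun _ => E x) (B' := fun _ => 0) hcont
      (fun t _ => (hφ t).hasDerivWithinAt) (by simp) (fun t => hasDerivAt_const t _) ?_
    intro t ht h
    have := hder t ht.1 h.le
    have h1 : 0 < (1 - t) * (L * ‖d‖ ^ 2) := mul_pos (by linarith [ht.2]) hc
    linarith
  have hfin : ∀ ⦃t : ℝ⦄, t ∈ Set.Icc (0 : ℝ) 1 →
      E (x + t • d) ≤ E x - (t - t ^ 2 / 2) * (L * ‖d‖ ^ 2) := by
    have hBd : ∀ t : ℝ, HasDerivAt (fun t : ℝ => E x - (t - t ^ 2 / 2) * (L * ‖d‖ ^ 2))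
        (-((1 - t) * (L * ‖d‖ ^ 2))) t := by
      intro t
      have := ((((hasDerivAt_id t).sub (((hasDerivAt_id t).pow 2).div_const 2)).mul_const
        (L * ‖d‖ ^ 2)).const_sub (E x))
      refine HasDerivAt.congr_deriv this ?_
      simp only [id, Nat.cast_ofNat]
      ring
    refine image_le_of_deriv_right_le_deriv_boundary hcont
      (fun t _ => (hφ t).hasDerivWithinAt) (by simp)
      (fun t _ => (hBd t).continuousAt.continuousWithinAt)
      (fun t _ => (hBd t).hasDerivWithinAt) ?_
    intro t ht
    exact hder t ht.1 (hB ⟨ht.1, ht.2.le⟩)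
  have := hfin (Set.right_mem_Icc.mpr zero_le_one)
  rw [one_smul] at this
  linarith

/-- FASD-ALS lower bound: one FASD iteration with the approximate (quadratic)
line search, step sizes α_i^q = −⟨E'(v_{i−1}), s_i⟩/(L‖s_i‖²), decreases the energy by at
least (L/2) Σ ‖α_i^q s_i‖². -/
theorem stmt_17
    {V : Type*} [NormedAddCommGroup V] [InnerProductSpace ℝ V] [CompleteSpace V]
    (E : V → ℝ) (E' : V → V →L[ℝ] ℝ)
    (hdiff : ∀ v : V, HasFDerivAt E (E' v) v)
    (μ L : ℝ) (hμ : 0 < μ) (hL : 0 < L) (u₀ : V)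
    (hE1 : ∀ v w : V, μ * ‖w - v‖ ^ 2 ≤ E' w (w - v) - E' v (w - v))
    (hE2 : ∀ v ∈ {x : V | E x ≤ E u₀}, ∀ w ∈ {x : V | E x ≤ E u₀},
      ‖E' w - E' v‖ ≤ L * ‖w - v‖)
    (N : ℕ) (Vsub : Fin N → Submodule ℝ V)
    (hclosed : ∀ i, IsClosed ((Vsub i : Set V)))
    (Q : Fin N → V →ₗ[ℝ] V)
    (hQmem : ∀ i x, Q i x ∈ Vsub i)
    (hQproj : ∀ i, ∀ x ∈ Vsub i, Q i x = x)
    (Ei : Fin N → V → ℝ) (Ei' : Fin N → V → V →L[ℝ] ℝ)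
    (hEidiff : ∀ i, ∀ x ∈ (Vsub i : Set V),
      HasFDerivWithinAt (Ei i) (Ei' i x) (Vsub i : Set V) x)
    (μi : Fin N → ℝ) (hμi : ∀ i, 0 < μi i)
    (hE3 : ∀ i, ∀ v ∈ Vsub i, ∀ w ∈ Vsub i,
      μi i * ‖w - v‖ ^ 2 ≤ Ei' i w (w - v) - Ei' i v (w - v))
    (v : Fin (N + 1) → V) (hv0 : E (v 0) ≤ E u₀)
    (ξ η s : Fin N → V) (αq : Fin N → ℝ)
    (hξ : ∀ i, ξ i = Q i (v i.castSucc))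
    (hηmem : ∀ i, η i ∈ Vsub i)
    (hres : ∀ i, ∀ w ∈ Vsub i,
      Ei' i (η i) w = Ei' i (ξ i) w - E' (v i.castSucc) w)
    (hs : ∀ i, s i = η i - ξ i) (hs0 : ∀ i, s i ≠ 0)
    (hαq : ∀ i, αq i = -(E' (v i.castSucc) (s i)) / (L * ‖s i‖ ^ 2))
    (hstep : ∀ i, v i.succ = v i.castSucc + αq i • s i) :
    L / 2 * ∑ i, ‖αq i • s i‖ ^ 2 ≤ E (v 0) - E (v (Fin.last N)) := by
  have key : ∀ i : Fin N, E (v i.castSucc) ≤ E u₀ →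
      L / 2 * ‖αq i • s i‖ ^ 2 ≤ E (v i.castSucc) - E (v i.succ) := by
    intro i hi
    rw [hstep i]
    refine step_aux E E' hdiff L hL u₀ hE2 _ _ hi ?_
    have hn : ‖s i‖ ≠ 0 := norm_ne_zero_iff.mpr (hs0 i)
    have h1 : E' (v i.castSucc) (s i) = -(αq i * (L * ‖s i‖ ^ 2)) := by
      rw [hαq i]; field_simp
    rw [map_smul, smul_eq_mul, h1, norm_smul, mul_pow, Real.norm_eq_abs, sq_abs]
    ring
  have hmem : ∀ j : Fin (N + 1), E (v j) ≤ E u₀ := by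
    intro j
    induction j using Fin.induction with
    | zero => exact hv0
    | succ i ih =>
      have := key i ih
      have h2 : 0 ≤ L / 2 * ‖αq i • s i‖ ^ 2 := by positivity
      linarith
  have htel : ∀ (n : ℕ) (f : Fin (n + 1) → ℝ),
      ∑ i : Fin n, (f i.castSucc - f i.succ) = f 0 - f (Fin.last n) := by
    intro n f
    have h1 := Fin.sum_univ_succ f
    have h2 := Fin.sum_univ_castSucc f
    rw [Finset.sum_sub_distrib]
    linarith
  rw [Finset.mul_sum, ← htel N (fun j => E (v j))]
  exact Finset.sum_le_sum fun i _ => key i (hmem _)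
end

section
/- (Consequence of the approximation property) Assume the energy E satisfies (E1) and (E2), and suppose both E and the local energy E_i : V_i → ℝ (V_i a closed subspace) are twice Fréchet differentiable satisfying the approximation property (AP) with constant 0 < ε < μ/2 relative to a linear projection Q_i : V → V_i with Q_i w = w for w ∈ V_i. Then for all v, w ∈ B ∩ V_i, (μ − ε)‖v − w‖² ≤ ⟨E_i'(v) − E_i'(w), v − w⟩ ≤ (L + ε)‖v − w‖². -/
/-- Consequence of the approximation property: if E satisfies (E1)–(E2) and the
pair (E, E_i) satisfies (AP) with constant 0 < ε < μ/2, then E_i' is strongly monotone with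
constant μ − ε and Lipschitz-bounded with constant L + ε on B ∩ V_i. -/
theorem stmt_18
    {V : Type*} [NormedAddCommGroup V] [InnerProductSpace ℝ V] [CompleteSpace V]
    (E : V → ℝ) (E' : V → V →L[ℝ] ℝ) (E'' : V → V →L[ℝ] V →L[ℝ] ℝ)
    (hdiff : ∀ v : V, HasFDerivAt E (E' v) v)
    (hdiff2 : ∀ v : V, HasFDerivAt E' (E'' v) v)
    (μ L : ℝ) (hμ : 0 < μ) (hL : 0 < L) (u₀ : V)
    (hE1 : ∀ v w : V, μ * ‖w - v‖ ^ 2 ≤ E' w (w - v) - E' v (w - v))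
    (hE2 : ∀ v ∈ {x : V | E x ≤ E u₀}, ∀ w ∈ {x : V | E x ≤ E u₀},
      ‖E' w - E' v‖ ≤ L * ‖w - v‖)
    (Vi : Submodule ℝ V) (hclosed : IsClosed ((Vi : Set V)))
    (Q : V →ₗ[ℝ] V) (hQmem : ∀ x, Q x ∈ Vi) (hQproj : ∀ x ∈ Vi, Q x = x)
    (Ei : V → ℝ) (Ei' : V → V →L[ℝ] ℝ) (Ei'' : V → V →L[ℝ] V →L[ℝ] ℝ)
    (hEid1 : ∀ x ∈ (Vi : Set V), HasFDerivWithinAt Ei (Ei' x) (Vi : Set V) x)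
    (hEid2 : ∀ x ∈ (Vi : Set V), HasFDerivWithinAt Ei' (Ei'' x) (Vi : Set V) x)
    (ε : ℝ) (hε0 : 0 < ε) (hεμ : ε < μ / 2)
    (hAP : ∀ w, E w ≤ E u₀ → ∀ ηv ∈ Vi, ∀ uu ∈ Vi, ∀ vv ∈ Vi,
      |E'' (w + ηv) uu vv - Ei'' (Q w + ηv) uu vv| ≤ ε * ‖uu‖ * ‖vv‖) :
    ∀ x ∈ Vi, E x ≤ E u₀ → ∀ y ∈ Vi, E y ≤ E u₀ →
      (μ - ε) * ‖x - y‖ ^ 2 ≤ Ei' x (x - y) - Ei' y (x - y) ∧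
      Ei' x (x - y) - Ei' y (x - y) ≤ (L + ε) * ‖x - y‖ ^ 2 := by
  intro x hx hxE y hy hyE
  set h := x - y with hh
  have hhV : h ∈ Vi := Vi.sub_mem hx hy
  have hmem : ∀ t : ℝ, t • h ∈ Vi := fun t => Vi.smul_mem t hhV
  have hline : ∀ t : ℝ, HasDerivAt (fun t : ℝ => y + t • h) h t := by
    intro t
    simpa using ((hasDerivAt_id t).smul_const h).const_add y
  have hd : ∀ t : ℝ, HasDerivWithinAt (fun t : ℝ => E' (y + t • h) h - Ei' (y + t • h) h)
      (E'' (y + t • h) h h - Ei'' (y + t • h) h h) Set.univ t := by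
    intro t
    have h1 : HasDerivWithinAt (fun t : ℝ => E' (y + t • h)) (E'' (y + t • h) h) Set.univ t :=
      ((hdiff2 (y + t • h)).comp_hasDerivAt t (hline t)).hasDerivWithinAt
    have h2 : HasDerivWithinAt (fun t : ℝ => Ei' (y + t • h)) (Ei'' (y + t • h) h) Set.univ t :=
      (hEid2 (y + t • h) (Vi.add_mem hy (hmem t))).comp_hasDerivWithinAt t
        (hline t).hasDerivWithinAt (fun s _ => Vi.add_mem hy (hmem s))
    have h3 := h1.clm_apply (hasDerivWithinAt_const t Set.univ h)
    have h4 := h2.clm_apply (hasDerivWithinAt_const t Set.univ h)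
    have h5 := h3.sub h4
    simp only [map_zero, add_zero] at h5
    exact h5
  have hb := Convex.norm_image_sub_le_of_norm_hasDerivWithin_le (C := ε * ‖h‖ * ‖h‖)
    (fun t _ => hd t) (fun t _ => by
      have := hAP y hyE (t • h) (hmem t) h hhV h hhV
      rw [hQproj y hy] at this
      simpa [Real.norm_eq_abs] using this) convex_univ (Set.mem_univ (0:ℝ)) (Set.mem_univ (1:ℝ))
  have hx1 : y + (1:ℝ) • h = x := by simp [hh]
  simp only [hx1, zero_smul, add_zero, sub_zero, norm_one, mul_one, Real.norm_eq_abs] at hb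
  have hb' := abs_le.mp hb
  have hlow := hE1 y x
  have hup : E' x h - E' y h ≤ L * ‖h‖ * ‖h‖ := by
    have a1 := (E' x - E' y).le_of_opNorm_le (hE2 y hyE x hxE) h
    have a2 := le_abs_self ((E' x - E' y) h)
    rw [Real.norm_eq_abs] at a1
    simp only [sub_apply] at a1 a2
    exact a2.trans a1
  rw [← hh] at hlow
  constructor <;> nlinarith [hb'.1, hb'.2]
end
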